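/- arXiv:1706.03268 — 8 statements merged into one kernel-verified Lean document; each statement's English description precedes it below -/
import Mathlib

section
/- Let R be a finite nonempty set of red points and B a finite set of blue points in ℝ². Let S = [x₁,x₂] × [y₁,y₂] be a closed axis-aligned rectangle with x₁ < x₂ and y₁ < y₂ such that: (i) R ⊆ S; (ii) for every closed axis-aligned rectangle Q containing R, the number of points of B in the interior of S is at most the number of points of B in the interior of Q; and (iii) S has area at least that of every closed axis-aligned rectangle Q containing R whose interior contains at most as many points of B as the interior of S does. Then each of the four closed sides of S contains a point of B; that is, there exist b_T, b_B, b_L, b_R ∈ B with b_T = (u, y₂) for some u ∈ [x₁,x₂], b_B = (v, y₁) for some v ∈ [x₁,x₂], b_L = (x₁, w) for some w ∈ [y₁,y₂], and b_R = (x₂, z) for some z ∈ [y₁,y₂]. -/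
open Filter Topology in
/-- Finitely many reals leave a gap immediately to the right of any point. -/
theorem Finset.exists_gt_forall_le_of_lt {α : Type*} (s : Finset α) (f : α → ℝ) (a : ℝ) :
    ∃ c, a < c ∧ ∀ p ∈ s, f p < c → f p ≤ a := by
  have h : ∀ᶠ c in 𝓝[>] a, ∀ p ∈ s, f p < c → f p ≤ a := by
    rw [Filter.eventually_all_finset]
    intro p _
    rcases le_or_gt (f p) a with hp | hp
    · exact Eventually.of_forall fun _ _ => hp
    · filter_upwards [Ioo_mem_nhdsGT hp] with c hc hpc
      exact absurd hc.2 hpc.not_gt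
  obtain ⟨c, hc, hac⟩ := (h.and self_mem_nhdsWithin).exists
  exact ⟨c, hac, hc⟩

/-- Finitely many reals leave a gap immediately to the left of any point. -/
theorem Finset.exists_lt_forall_ge_of_gt {α : Type*} (s : Finset α) (f : α → ℝ) (a : ℝ) :
    ∃ c, c < a ∧ ∀ p ∈ s, c < f p → a ≤ f p := by
  obtain ⟨c, hc, h⟩ := s.exists_gt_forall_le_of_lt (fun p => -f p) (-a)
  exact ⟨-c, by linarith, fun p hp hcp => neg_le_neg_iff.mp (h p hp (by linarith))⟩


/-- **Observation 2.1.**  If `S = [x₁,x₂] × [y₁,y₂]` is a maximum separating rectangle for a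
nonempty finite set `R` of red points and a finite set `B` of blue points — i.e. `S` contains all
red points, the number of blue points interior to `S` is minimum among all closed axis-aligned
rectangles containing `R`, and `S` has maximum area among all rectangles containing `R` whose
interiors contain at most as many blue points — then `S` has a blue point on each of its four
closed sides. -/
theorem maximum_separating_rectangle_has_blue_point_on_each_side
    (R B : Finset (ℝ × ℝ)) (hRne : R.Nonempty)
    (x₁ x₂ y₁ y₂ : ℝ) (hx : x₁ < x₂) (hy : y₁ < y₂)
    (hRS : ∀ p ∈ R, p ∈ Set.Icc x₁ x₂ ×ˢ Set.Icc y₁ y₂)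
    (hmin : ∀ a₁ a₂ b₁ b₂ : ℝ, a₁ ≤ a₂ → b₁ ≤ b₂ →
      (∀ p ∈ R, p ∈ Set.Icc a₁ a₂ ×ˢ Set.Icc b₁ b₂) →
      (B.filter (fun p => x₁ < p.1 ∧ p.1 < x₂ ∧ y₁ < p.2 ∧ p.2 < y₂)).card ≤
        (B.filter (fun p => a₁ < p.1 ∧ p.1 < a₂ ∧ b₁ < p.2 ∧ p.2 < b₂)).card)
    (hmax : ∀ a₁ a₂ b₁ b₂ : ℝ, a₁ ≤ a₂ → b₁ ≤ b₂ →
      (∀ p ∈ R, p ∈ Set.Icc a₁ a₂ ×ˢ Set.Icc b₁ b₂) →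
      (B.filter (fun p => a₁ < p.1 ∧ p.1 < a₂ ∧ b₁ < p.2 ∧ p.2 < b₂)).card ≤
        (B.filter (fun p => x₁ < p.1 ∧ p.1 < x₂ ∧ y₁ < p.2 ∧ p.2 < y₂)).card →
      (a₂ - a₁) * (b₂ - b₁) ≤ (x₂ - x₁) * (y₂ - y₁)) :
    (∃ bT ∈ B, bT.2 = y₂ ∧ bT.1 ∈ Set.Icc x₁ x₂) ∧
    (∃ bB ∈ B, bB.2 = y₁ ∧ bB.1 ∈ Set.Icc x₁ x₂) ∧
    (∃ bL ∈ B, bL.1 = x₁ ∧ bL.2 ∈ Set.Icc y₁ y₂) ∧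
    (∃ bR ∈ B, bR.1 = x₂ ∧ bR.2 ∈ Set.Icc y₁ y₂) := by
  refine ⟨?_, ?_, ?_, ?_⟩
  · by_contra hno
    obtain ⟨c, hlt, hc⟩ := B.exists_gt_forall_le_of_lt (fun p => p.2) y₂
    refine (hmax x₁ x₂ y₁ c (by linarith) (by linarith) (fun p hp => ?_)
      (Finset.card_le_card fun p hp => ?_)).not_gt (by nlinarith)
    · obtain ⟨⟨h1, h2⟩, h3, h4⟩ := hRS p hp
      exact ⟨⟨by linarith, by linarith⟩, by linarith, by linarith⟩
    · rw [Finset.mem_filter] at hp ⊢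
      obtain ⟨hp, h1, h2, h3, h4⟩ := hp
      have hne : p.2 ≠ y₂ := fun h => hno ⟨p, hp, h, ⟨h1.le, h2.le⟩⟩
      exact ⟨hp, ⟨h1, h2, h3, lt_of_le_of_ne (hc p hp h4) hne⟩⟩
  · by_contra hno
    obtain ⟨c, hlt, hc⟩ := B.exists_lt_forall_ge_of_gt (fun p => p.2) y₁
    refine (hmax x₁ x₂ c y₂ (by linarith) (by linarith) (fun p hp => ?_)
      (Finset.card_le_card fun p hp => ?_)).not_gt (by nlinarith)
    · obtain ⟨⟨h1, h2⟩, h3, h4⟩ := hRS p hp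
      exact ⟨⟨by linarith, by linarith⟩, by linarith, by linarith⟩
    · rw [Finset.mem_filter] at hp ⊢
      obtain ⟨hp, h1, h2, h3, h4⟩ := hp
      have hne : p.2 ≠ y₁ := fun h => hno ⟨p, hp, h, ⟨h1.le, h2.le⟩⟩
      exact ⟨hp, ⟨h1, h2, lt_of_le_of_ne (hc p hp h3) (Ne.symm hne), h4⟩⟩
  · by_contra hno
    obtain ⟨c, hlt, hc⟩ := B.exists_lt_forall_ge_of_gt (fun p => p.1) x₁
    refine (hmax c x₂ y₁ y₂ (by linarith) (by linarith) (fun p hp => ?_)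
      (Finset.card_le_card fun p hp => ?_)).not_gt (by nlinarith)
    · obtain ⟨⟨h1, h2⟩, h3, h4⟩ := hRS p hp
      exact ⟨⟨by linarith, by linarith⟩, by linarith, by linarith⟩
    · rw [Finset.mem_filter] at hp ⊢
      obtain ⟨hp, h1, h2, h3, h4⟩ := hp
      have hne : p.1 ≠ x₁ := fun h => hno ⟨p, hp, h, ⟨h3.le, h4.le⟩⟩
      exact ⟨hp, ⟨lt_of_le_of_ne (hc p hp h1) (Ne.symm hne), h2, h3, h4⟩⟩
  · by_contra hno
    obtain ⟨c, hlt, hc⟩ := B.exists_gt_forall_le_of_lt (fun p => p.1) x₂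
    refine (hmax x₁ c y₁ y₂ (by linarith) (by linarith) (fun p hp => ?_)
      (Finset.card_le_card fun p hp => ?_)).not_gt (by nlinarith)
    · obtain ⟨⟨h1, h2⟩, h3, h4⟩ := hRS p hp
      exact ⟨⟨by linarith, by linarith⟩, by linarith, by linarith⟩
    · rw [Finset.mem_filter] at hp ⊢
      obtain ⟨hp, h1, h2, h3, h4⟩ := hp
      have hne : p.1 ≠ x₂ := fun h => hno ⟨p, hp, h, ⟨h3.le, h4.le⟩⟩
      exact ⟨hp, ⟨h1, lt_of_le_of_ne (hc p hp h2) hne, h3, h4⟩⟩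
end

section
/- Let R be a finite nonempty set of red points in ℝ² with bounding box S_min = [x_L,x_R] × [y_B,y_T] (so x_L, x_R are the minimum and maximum first coordinates of points of R, and y_B, y_T the minimum and maximum second coordinates). Let B be a finite set of blue points none of which has first coordinate equal to x_L or x_R, nor second coordinate equal to y_B or y_T. Suppose there exist points t, b, l, r ∈ B with x_L ≤ t₁ ≤ x_R and t₂ > y_T; x_L ≤ b₁ ≤ x_R and b₂ < y_B; y_B ≤ l₂ ≤ y_T and l₁ < x_L; y_B ≤ r₂ ≤ y_T and r₁ > x_R. Set S_max = [l₁, r₁] × [b₂, t₂]. Then every closed axis-aligned rectangle Q such that R ⊆ Q and the interior of Q contains no point of B satisfies Q ⊆ S_max. Consequently, if the interior of S_max contains no point of B, then S_max has maximum area among all closed axis-aligned rectangles containing R whose interiors contain no point of B. -/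
/-- `S_max` bounds the solution space: every closed axis-aligned rectangle containing all the red
points and whose interior contains no blue point is contained in `S_max = [l₁,r₁] × [b₂,t₂]`,
where `t, b, l, r` are the blue points hit when sliding each side of the bounding box `S_min` of
the red points outwards.  Consequently, if the interior of `S_max` contains no blue point, then
`S_max` is itself a rectangle containing all red points with blue-point-free interior, and it has
maximum area among all such rectangles. -/
theorem smax_bounds_solution_space
    (R B : Finset (ℝ × ℝ)) (hRne : R.Nonempty)
    (xL xR yB yT : ℝ)
    (hxLlb : ∀ p ∈ R, xL ≤ p.1) (hxLmem : ∃ p ∈ R, p.1 = xL)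
    (hxRub : ∀ p ∈ R, p.1 ≤ xR) (hxRmem : ∃ p ∈ R, p.1 = xR)
    (hyBlb : ∀ p ∈ R, yB ≤ p.2) (hyBmem : ∃ p ∈ R, p.2 = yB)
    (hyTub : ∀ p ∈ R, p.2 ≤ yT) (hyTmem : ∃ p ∈ R, p.2 = yT)
    (hBgen : ∀ p ∈ B, p.1 ≠ xL ∧ p.1 ≠ xR ∧ p.2 ≠ yB ∧ p.2 ≠ yT)
    (t b l r : ℝ × ℝ) (htB : t ∈ B) (hbB : b ∈ B) (hlB : l ∈ B) (hrB : r ∈ B)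
    (ht : xL ≤ t.1 ∧ t.1 ≤ xR ∧ yT < t.2)
    (hb : xL ≤ b.1 ∧ b.1 ≤ xR ∧ b.2 < yB)
    (hl : yB ≤ l.2 ∧ l.2 ≤ yT ∧ l.1 < xL)
    (hr : yB ≤ r.2 ∧ r.2 ≤ yT ∧ xR < r.1) :
    (∀ a₁ a₂ b₁ b₂ : ℝ, a₁ ≤ a₂ → b₁ ≤ b₂ →
      (∀ p ∈ R, p ∈ Set.Icc a₁ a₂ ×ˢ Set.Icc b₁ b₂) →
      (∀ p ∈ B, p ∉ Set.Ioo a₁ a₂ ×ˢ Set.Ioo b₁ b₂) →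
      Set.Icc a₁ a₂ ×ˢ Set.Icc b₁ b₂ ⊆ Set.Icc l.1 r.1 ×ˢ Set.Icc b.2 t.2) ∧
    ((∀ p ∈ B, p ∉ Set.Ioo l.1 r.1 ×ˢ Set.Ioo b.2 t.2) →
      (∀ p ∈ R, p ∈ Set.Icc l.1 r.1 ×ˢ Set.Icc b.2 t.2) ∧
      ∀ a₁ a₂ b₁ b₂ : ℝ, a₁ ≤ a₂ → b₁ ≤ b₂ →
        (∀ p ∈ R, p ∈ Set.Icc a₁ a₂ ×ˢ Set.Icc b₁ b₂) →
        (∀ p ∈ B, p ∉ Set.Ioo a₁ a₂ ×ˢ Set.Ioo b₁ b₂) →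
        (a₂ - a₁) * (b₂ - b₁) ≤ (r.1 - l.1) * (t.2 - b.2)) := by
  have bounds : ∀ a₁ a₂ b₁ b₂ : ℝ,
      (∀ p ∈ R, p ∈ Set.Icc a₁ a₂ ×ˢ Set.Icc b₁ b₂) →
      (∀ p ∈ B, p ∉ Set.Ioo a₁ a₂ ×ˢ Set.Ioo b₁ b₂) →
      l.1 ≤ a₁ ∧ a₂ ≤ r.1 ∧ b.2 ≤ b₁ ∧ b₂ ≤ t.2 := by
    intro a₁ a₂ b₁ b₂ hR hB
    obtain ⟨p, hp, rfl⟩ := hxLmem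
    obtain ⟨q, hq, rfl⟩ := hxRmem
    obtain ⟨u, hu, rfl⟩ := hyBmem
    obtain ⟨v, hv, rfl⟩ := hyTmem
    have hpa := (hR p hp).1.1
    have hqa := (hR q hq).1.2
    have hub := (hR u hu).2.1
    have hvb := (hR v hv).2.2
    obtain ⟨htL, htR, -, -⟩ := hBgen t htB
    obtain ⟨hbL, hbR, -, -⟩ := hBgen b hbB
    obtain ⟨-, -, hlb, hlt⟩ := hBgen l hlB
    obtain ⟨-, -, hrb, hrt⟩ := hBgen r hrB
    have htL := lt_of_le_of_ne ht.1 htL.symm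
    have htR := lt_of_le_of_ne ht.2.1 htR
    have hbL := lt_of_le_of_ne hb.1 hbL.symm
    have hbR := lt_of_le_of_ne hb.2.1 hbR
    have hlb := lt_of_le_of_ne hl.1 hlb.symm
    have hlt := lt_of_le_of_ne hl.2.1 hlt
    have hrb := lt_of_le_of_ne hr.1 hrb.symm
    have hrt := lt_of_le_of_ne hr.2.1 hrt
    refine ⟨?_, ?_, ?_, ?_⟩ <;> by_contra! h
    · exact hB l hlB ⟨⟨h, by linarith⟩, by linarith, by linarith⟩
    · exact hB r hrB ⟨⟨by linarith, h⟩, by linarith, by linarith⟩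
    · exact hB b hbB ⟨⟨by linarith, by linarith⟩, h, by linarith⟩
    · exact hB t htB ⟨⟨by linarith, by linarith⟩, by linarith, h⟩
  refine ⟨fun a₁ a₂ b₁ b₂ _ _ hR hB => ?_, fun _ => ⟨fun p hp => ?_, ?_⟩⟩
  · obtain ⟨h₁, h₂, h₃, h₄⟩ := bounds a₁ a₂ b₁ b₂ hR hB
    exact Set.prod_mono (Set.Icc_subset_Icc h₁ h₂) (Set.Icc_subset_Icc h₃ h₄)
  · exact ⟨⟨hl.2.2.le.trans (hxLlb p hp), (hxRub p hp).trans hr.2.2.le⟩,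
      hb.2.2.le.trans (hyBlb p hp), (hyTub p hp).trans ht.2.2.le⟩
  · intro a₁ a₂ b₁ b₂ ha hb' hR hB
    obtain ⟨h₁, h₂, h₃, h₄⟩ := bounds a₁ a₂ b₁ b₂ hR hB
    exact mul_le_mul (by linarith) (by linarith) (by linarith) (by linarith)
end

section
/- For every integer m ≥ 5 there exist a set R of 4 red points and a set B of m blue points in ℝ² such that there are at least m − 3 pairwise distinct closed axis-aligned rectangles S, each of which contains all points of R, has no point of B in its interior, and has maximum area among all closed axis-aligned rectangles that contain all points of R and have no point of B in their interior. In other words, in the worst case there are Ω(m) maximum separating rectangles. -/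
/-- The closed axis-aligned rectangle with lower-left corner `a` and upper-right corner `b`. -/
def closedRect (a b : ℝ × ℝ) : Set (ℝ × ℝ) :=
  Set.Icc a.1 b.1 ×ˢ Set.Icc a.2 b.2

/-- The interior (open rectangle) of the closed rectangle with corners `a` and `b`. -/
def openRect (a b : ℝ × ℝ) : Set (ℝ × ℝ) :=
  Set.Ioo a.1 b.1 ×ˢ Set.Ioo a.2 b.2

/-- The area of the closed rectangle with corners `a` and `b`. -/
def rectArea (a b : ℝ × ℝ) : ℝ :=
  (b.1 - a.1) * (b.2 - a.2)

/-- `a, b` define a maximum separating rectangle for red points `R` and blue points `B`: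
it is a genuine rectangle, contains all red points, contains no blue point in its interior, and
has maximum area among all closed axis-aligned rectangles containing all red points with no blue
point in their interior. -/
def IsMaxSepRect (R B : Finset (ℝ × ℝ)) (a b : ℝ × ℝ) : Prop :=
  a.1 ≤ b.1 ∧ a.2 ≤ b.2 ∧
  (∀ p ∈ R, p ∈ closedRect a b) ∧
  (∀ p ∈ B, p ∉ openRect a b) ∧
  ∀ a' b' : ℝ × ℝ, a'.1 ≤ b'.1 → a'.2 ≤ b'.2 →
    (∀ p ∈ R, p ∈ closedRect a' b') → (∀ p ∈ B, p ∉ openRect a' b') →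
    rectArea a' b' ≤ rectArea a b

/-- The blue points bounding the rectangles from the top right: a staircase just below the
hyperbola `x * y = 1`. -/
noncomputable def stairPoint (j : ℕ) : ℝ × ℝ := (max (1 / 3) j, 1 / (j + 1))

/-- The upper-right corners of the maximum rectangles, which lie on the hyperbola `x * y = 1`. -/
noncomputable def hyperbolaCorner (j : ℕ) : ℝ × ℝ := (j + 1, 1 / (j + 1))

/-- The four corners of a small box near the origin. -/
noncomputable def redBox (n : ℕ) : Finset (ℝ × ℝ) :=
  {1 / 4, 1 / 2} ×ˢ {1 / (4 * n : ℝ), 1 / (2 * n : ℝ)}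

/-- The staircase of `n` points together with a left, a bottom and a right barrier. -/
noncomputable def blueStair (n : ℕ) : Finset (ℝ × ℝ) :=
  insert (0, 1 / (3 * n : ℝ)) (insert (1 / 3, 0) (insert ((n : ℝ), 1 / (3 * n : ℝ))
    ((Finset.range n).image stairPoint)))

lemma stairPoint_injective : Function.Injective stairPoint := by
  intro i j h
  have h2 : (1 : ℝ) / (i + 1) = 1 / (j + 1) := congrArg Prod.snd h
  have h3 : (i : ℝ) + 1 = j + 1 := by simpa using h2
  exact_mod_cast add_right_cancel h3

lemma card_redBox {n : ℕ} (hn : 0 < n) : (redBox n).card = 4 := by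
  have hn' : (0 : ℝ) < n := by exact_mod_cast hn
  have h : 1 / (4 * n : ℝ) ≠ 1 / (2 * n : ℝ) := by
    intro h
    field_simp at h
    norm_num at h
  rw [redBox, Finset.card_product, Finset.card_pair (by norm_num), Finset.card_pair h]

lemma card_blueStair {n : ℕ} (hn : 0 < n) : (blueStair n).card = n + 3 := by
  have hn' : (1 : ℝ) ≤ n := by exact_mod_cast hn
  have hpos : (0 : ℝ) < 1 / (3 * n) := by positivity
  have hR : ((n : ℝ), 1 / (3 * n : ℝ)) ∉ (Finset.range n).image stairPoint := by
    simp only [Finset.mem_image, Finset.mem_range, not_exists, not_and]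
    intro j hj h
    have h1 : max (1 / 3) (j : ℝ) = n := congrArg Prod.fst h
    have hj' : (j : ℝ) < n := by exact_mod_cast hj
    have : max (1 / 3) (j : ℝ) < n := max_lt (by linarith) hj'
    linarith
  have hD : ((1 / 3 : ℝ), (0 : ℝ)) ∉ insert ((n : ℝ), 1 / (3 * n : ℝ))
      ((Finset.range n).image stairPoint) := by
    simp only [Finset.mem_insert, Finset.mem_image, Finset.mem_range, not_or, not_exists, not_and]
    refine ⟨fun h => hpos.ne (congrArg Prod.snd h), fun j _ h => ?_⟩
    have h2 : (1 : ℝ) / (j + 1) = 0 := congrArg Prod.snd h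
    have : (0 : ℝ) < 1 / (j + 1) := by positivity
    linarith
  have hL : ((0 : ℝ), 1 / (3 * n : ℝ)) ∉ insert ((1 / 3 : ℝ), (0 : ℝ))
      (insert ((n : ℝ), 1 / (3 * n : ℝ)) ((Finset.range n).image stairPoint)) := by
    simp only [Finset.mem_insert, Finset.mem_image, Finset.mem_range, not_or, not_exists, not_and]
    refine ⟨fun h => hpos.ne' (congrArg Prod.snd h), fun h => ?_, fun j _ h => ?_⟩
    · have h1 : (0 : ℝ) = n := congrArg Prod.fst h
      linarith
    · have h1 : max (1 / 3) (j : ℝ) = 0 := congrArg Prod.fst h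
      have := le_max_left (1 / 3) (j : ℝ)
      linarith
  rw [blueStair, Finset.card_insert_of_notMem hL, Finset.card_insert_of_notMem hD,
    Finset.card_insert_of_notMem hR, Finset.card_image_of_injective _ stairPoint_injective,
    Finset.card_range]

/-- Every rectangle separating `redBox n` from `blueStair n` has area at most `1`. -/
lemma rectArea_le_one {n : ℕ} (hn : 0 < n) {a b : ℝ × ℝ}
    (hR : ∀ p ∈ redBox n, p ∈ closedRect a b) (hB : ∀ p ∈ blueStair n, p ∉ openRect a b) :
    rectArea a b ≤ 1 := by
  have hn' : (0 : ℝ) < n := by exact_mod_cast hn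
  have hlow : 1 / (4 * n : ℝ) < 1 / (3 * n) := by gcongr; norm_num
  have hhigh : 1 / (3 * n : ℝ) < 1 / (2 * n) := by gcongr; norm_num
  have hpos : (0 : ℝ) < 1 / (4 * n) := by positivity
  obtain ⟨⟨ha1, -⟩, ha2, -⟩ := hR (1 / 4, 1 / (4 * n)) (by simp [redBox])
  obtain ⟨⟨-, hb1⟩, -, hb2⟩ := hR (1 / 2, 1 / (2 * n)) (by simp [redBox])
  dsimp only at ha1 ha2 hb1 hb2
  have hleft : 0 ≤ a.1 := by
    by_contra! h
    refine hB (0, 1 / (3 * n)) (by simp [blueStair]) ⟨⟨h, ?_⟩, ?_, ?_⟩ <;> dsimp only <;> linarith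
  have hbot : 0 ≤ a.2 := by
    by_contra! h
    refine hB (1 / 3, 0) (by simp [blueStair]) ⟨⟨?_, ?_⟩, h, ?_⟩ <;> dsimp only <;> linarith
  have hright : b.1 ≤ n := by
    by_contra! h
    refine hB (n, 1 / (3 * n)) (by simp [blueStair]) ⟨⟨?_, h⟩, ?_, ?_⟩ <;> dsimp only <;>
      linarith [show (1 : ℝ) ≤ n by exact_mod_cast hn]
  obtain ⟨j, hj⟩ : ∃ j, ⌈b.1⌉₊ = j + 1 :=
    Nat.exists_eq_succ_of_ne_zero (Nat.ceil_pos.2 (by linarith)).ne'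
  have hjn : j < n := by
    have := Nat.ceil_le.2 hright
    omega
  have hbj : b.1 ≤ j + 1 := by
    have := Nat.le_ceil b.1
    rw [hj] at this
    exact_mod_cast this
  have hjb : (j : ℝ) < b.1 := Nat.lt_ceil.1 (by omega)
  have htop : b.2 ≤ 1 / (j + 1) := by
    by_contra! h
    have hle : 1 / (n : ℝ) ≤ 1 / (j + 1) := by
      gcongr
      exact_mod_cast hjn
    have hlt : 1 / (4 * n : ℝ) < 1 / n := by
      gcongr
      linarith
    refine hB (stairPoint j) ?_ ⟨⟨?_, max_lt (by linarith) hjb⟩, ?_, h⟩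
    · simp only [blueStair, Finset.mem_insert, Finset.mem_image, Finset.mem_range]
      exact Or.inr (Or.inr (Or.inr ⟨j, hjn, rfl⟩))
    · exact lt_of_lt_of_le (by linarith) (le_max_left _ _)
    · dsimp only [stairPoint]
      linarith
  calc (b.1 - a.1) * (b.2 - a.2) ≤ (j + 1) * (1 / (j + 1)) := by
        apply mul_le_mul <;> linarith
    _ = 1 := mul_one_div_cancel (by positivity)

lemma isMaxSepRect_hyperbolaCorner {n j : ℕ} (hj : j < n) :
    IsMaxSepRect (redBox n) (blueStair n) (0, 0) (hyperbolaCorner j) := by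
  have hn : 0 < n := by omega
  have hn' : (0 : ℝ) < n := by exact_mod_cast hn
  have hjn : (j : ℝ) + 1 ≤ n := by exact_mod_cast hj
  have hj0 : (0 : ℝ) ≤ j := j.cast_nonneg
  have harea : rectArea (0, 0) (hyperbolaCorner j) = 1 := by
    simp only [rectArea, hyperbolaCorner, sub_zero]
    exact mul_one_div_cancel (by positivity)
  refine ⟨by dsimp only [hyperbolaCorner]; positivity, by dsimp only [hyperbolaCorner]; positivity,
    ?_, ?_, fun a b _ _ hR hB => harea ▸ rectArea_le_one hn hR hB⟩
  · have h2 : 1 / (2 * n : ℝ) ≤ 1 / (j + 1) := by gcongr; linarith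
    have h4 : 1 / (4 * n : ℝ) ≤ 1 / (j + 1) := by gcongr; linarith
    rintro ⟨x, y⟩ hp
    simp only [redBox, Finset.mem_product, Finset.mem_insert, Finset.mem_singleton] at hp
    obtain ⟨rfl | rfl, rfl | rfl⟩ := hp <;>
      refine ⟨⟨?_, ?_⟩, ?_, ?_⟩ <;> dsimp only [hyperbolaCorner] <;>
      first | positivity | assumption | linarith
  · intro p hp hmem
    simp only [blueStair, Finset.mem_insert, Finset.mem_image, Finset.mem_range] at hp
    obtain ⟨⟨h1, h2⟩, h3, h4⟩ := hmem
    dsimp only [hyperbolaCorner] at h1 h2 h3 h4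
    obtain rfl | rfl | rfl | ⟨i, -, rfl⟩ := hp
    · exact lt_irrefl _ h1
    · exact lt_irrefl _ h3
    · dsimp only at h2
      linarith
    · dsimp only [stairPoint] at h2 h4
      have hi : (i : ℝ) < j + 1 := (le_max_right _ _).trans_lt h2
      have hij : (i : ℝ) ≤ j := by
        have : i < j + 1 := by exact_mod_cast hi
        exact_mod_cast Nat.lt_succ_iff.1 this
      have : 1 / ((j : ℝ) + 1) ≤ 1 / (i + 1) := by gcongr
      linarith

lemma hyperbolaCorner_injective : Function.Injective hyperbolaCorner := by
  intro i j h
  have h1 : (i : ℝ) + 1 = j + 1 := congrArg Prod.fst h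
  exact_mod_cast add_right_cancel h1

/-- A nonempty closed rectangle determines its upper-right corner. -/
lemma eq_of_closedRect_eq {a b b' : ℝ × ℝ} (hb : a ≤ b) (hb' : a ≤ b')
    (h : closedRect a b = closedRect a b') : b = b' := by
  have hmem : b ∈ closedRect a b' := h ▸ ⟨⟨hb.1, le_rfl⟩, hb.2, le_rfl⟩
  have hmem' : b' ∈ closedRect a b := h ▸ ⟨⟨hb'.1, le_rfl⟩, hb'.2, le_rfl⟩
  exact Prod.ext (le_antisymm hmem.1.2 hmem'.1.2) (le_antisymm hmem.2.2 hmem'.2.2)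

/-- **Theorem 2.1.**  In the worst case there are `Ω(m)` maximum separating rectangles: for every
`m ≥ 5` there are a set of `4` red points and a set of `m` blue points admitting at least `m - 3`
pairwise distinct maximum separating rectangles. -/
theorem omega_m_maximum_separating_rectangles (m : ℕ) (hm : 5 ≤ m) :
    ∃ R B : Finset (ℝ × ℝ), R.card = 4 ∧ B.card = m ∧
      ∃ T : Finset ((ℝ × ℝ) × (ℝ × ℝ)),
        m - 3 ≤ T.card ∧
        (∀ s ∈ T, IsMaxSepRect R B s.1 s.2) ∧
        (∀ s ∈ T, ∀ s' ∈ T, s ≠ s' → closedRect s.1 s.2 ≠ closedRect s'.1 s'.2) := by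
  have hn : 0 < m - 3 := by omega
  refine ⟨redBox (m - 3), blueStair (m - 3), card_redBox hn, ?_,
    (Finset.range (m - 3)).image fun j => ((0, 0), hyperbolaCorner j), ?_, ?_, ?_⟩
  · rw [card_blueStair hn]
    omega
  · rw [Finset.card_image_of_injective _
      fun i j h => hyperbolaCorner_injective (congrArg Prod.snd h), Finset.card_range]
  · simp only [Finset.mem_image, Finset.mem_range]
    rintro _ ⟨j, hj, rfl⟩
    exact isMaxSepRect_hyperbolaCorner hj
  · simp only [Finset.mem_image, Finset.mem_range]
    rintro _ ⟨i, hi, rfl⟩ _ ⟨j, hj, rfl⟩ hne h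
    have hi' := isMaxSepRect_hyperbolaCorner hi
    have hj' := isMaxSepRect_hyperbolaCorner hj
    exact hne (congrArg (Prod.mk (0, 0))
      (eq_of_closedRect_eq ⟨hi'.1, hi'.2.1⟩ ⟨hj'.1, hj'.2.1⟩ h))
end

section
/- Let m ≥ 5 be an integer and x₀, y₀ > 0 real numbers. Let x₁ < x₂ < ⋯ < x_{m−2} be real numbers with −3x₀/2 < x₁ and x_{m−2} < 0, and for each i with 2 ≤ i ≤ m − 2 define y_i = y₀/2 − x₀y₀/(x₀/2 − x_{i−1}). Define the four red points s_E = (x₀/2, 0), s_N = (0, y₀/2), s_W = (x_{m−3}, 0), s_S = (0, y₂). Then for every i with 2 ≤ i ≤ m − 2, each y_i satisfies y_i < 0 and the closed rectangle S_i = [x_{i−1}, x₀/2] × [y_i, y₀/2] contains all four red points s_E, s_N, s_W, s_S. -/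
/-- In the lower-bound construction of Theorem 2.1 (with `m ≥ 5`, `x₀, y₀ > 0`, strictly
increasing abscissas `x₁ < ⋯ < x_{m-2}` in `(-3x₀/2, 0)` and
`y_i = y₀/2 − x₀y₀/(x₀/2 − x_{i−1})` for `2 ≤ i ≤ m − 2`), each `y_i` is negative and each closed
rectangle `S_i = [x_{i−1}, x₀/2] × [y_i, y₀/2]` contains the four red points
`s_E = (x₀/2, 0)`, `s_N = (0, y₀/2)`, `s_W = (x_{m−3}, 0)`, `s_S = (0, y₂)`. -/
theorem lower_bound_rectangles_contain_red_points
    (m : ℕ) (hm : 5 ≤ m) (x₀ y₀ : ℝ) (hx₀ : 0 < x₀) (hy₀ : 0 < y₀)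
    (x : ℕ → ℝ)
    (hmono : ∀ i j : ℕ, 1 ≤ i → i < j → j ≤ m - 2 → x i < x j)
    (hx1 : -(3 * x₀) / 2 < x 1) (hxlast : x (m - 2) < 0)
    (y : ℕ → ℝ)
    (hy : ∀ i : ℕ, 2 ≤ i → i ≤ m - 2 → y i = y₀ / 2 - x₀ * y₀ / (x₀ / 2 - x (i - 1))) :
    ∀ i : ℕ, 2 ≤ i → i ≤ m - 2 →
      y i < 0 ∧
      ((x₀ / 2, (0 : ℝ)) ∈ Set.Icc (x (i - 1)) (x₀ / 2) ×ˢ Set.Icc (y i) (y₀ / 2)) ∧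
      (((0 : ℝ), y₀ / 2) ∈ Set.Icc (x (i - 1)) (x₀ / 2) ×ˢ Set.Icc (y i) (y₀ / 2)) ∧
      ((x (m - 3), (0 : ℝ)) ∈ Set.Icc (x (i - 1)) (x₀ / 2) ×ˢ Set.Icc (y i) (y₀ / 2)) ∧
      (((0 : ℝ), y 2) ∈ Set.Icc (x (i - 1)) (x₀ / 2) ×ˢ Set.Icc (y i) (y₀ / 2)) := by
  have hx_le : ∀ i j : ℕ, 1 ≤ i → i ≤ j → j ≤ m - 2 → x i ≤ x j := by
    intro i j hi hij hj
    rcases hij.eq_or_lt with rfl | h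
    · exact le_rfl
    · exact (hmono i j hi h hj).le
  intro i hi him
  have hx1i : x 1 ≤ x (i - 1) := hx_le _ _ le_rfl (by omega) (by omega)
  have hxi : x (i - 1) ≤ x (m - 3) := hx_le _ _ (by omega) (by omega) (by omega)
  have hxm : x (m - 3) ≤ x (m - 2) := hx_le _ _ (by omega) (by omega) le_rfl
  have hd : 0 < x₀ / 2 - x (i - 1) := by linarith
  have hd1 : x₀ / 2 - x 1 < 2 * x₀ := by linarith
  have hy2 : y 2 < 0 := by
    rw [hy 2 le_rfl (by omega), sub_neg, lt_div_iff₀ (by linarith)]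
    nlinarith
  have hyi2 : y i ≤ y 2 := by
    rw [hy i hi him, hy 2 le_rfl (by omega)]
    have : x₀ * y₀ / (x₀ / 2 - x 1) ≤ x₀ * y₀ / (x₀ / 2 - x (i - 1)) := by gcongr
    exact sub_le_sub_left this _
  have hyi : y i < 0 := hyi2.trans_lt hy2
  simp only [Set.mem_prod, Set.mem_Icc]
  refine ⟨hyi, ?_, ?_, ?_, ?_⟩ <;> refine ⟨⟨?_, ?_⟩, ?_, ?_⟩ <;> linarith
end

section
/- Let m ≥ 5 be an integer and x₀, y₀ > 0 real numbers. Let x₁ < x₂ < ⋯ < x_{m−2} be real numbers with −3x₀/2 < x₁ and x_{m−2} < 0; for each i with 2 ≤ i ≤ m − 2 define y_i = y₀/2 − x₀y₀/(x₀/2 − x_{i−1}), and let y₁ be any real number with y₂ < y₁ < 0. Define the blue points p = (x₀/4, y₀/2), q = (x₀/2, y₀/4), and r_j = (x_j, y_j) for 1 ≤ j ≤ m − 2. Then for every i with 2 ≤ i ≤ m − 2, the open rectangle (x_{i−1}, x₀/2) × (y_i, y₀/2) contains none of the m blue points p, q, r₁, …, r_{m−2}. -/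
/-- In the lower-bound construction of Theorem 2.1 (with `m ≥ 5`, `x₀, y₀ > 0`, strictly
increasing abscissas `x₁ < ⋯ < x_{m-2}` in `(-3x₀/2, 0)`,
`y_i = y₀/2 − x₀y₀/(x₀/2 − x_{i−1})` for `2 ≤ i ≤ m − 2`, and `y₂ < y₁ < 0`), the interior
`(x_{i−1}, x₀/2) × (y_i, y₀/2)` of every rectangle `S_i` contains none of the `m` blue points
`p = (x₀/4, y₀/2)`, `q = (x₀/2, y₀/4)`, `r_j = (x_j, y_j)` for `1 ≤ j ≤ m − 2`. -/
theorem lower_bound_rectangles_are_blue_empty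
    (m : ℕ) (hm : 5 ≤ m) (x₀ y₀ : ℝ) (hx₀ : 0 < x₀) (hy₀ : 0 < y₀)
    (x : ℕ → ℝ)
    (hmono : ∀ i j : ℕ, 1 ≤ i → i < j → j ≤ m - 2 → x i < x j)
    (hx1 : -(3 * x₀) / 2 < x 1) (hxlast : x (m - 2) < 0)
    (y : ℕ → ℝ)
    (hy : ∀ i : ℕ, 2 ≤ i → i ≤ m - 2 → y i = y₀ / 2 - x₀ * y₀ / (x₀ / 2 - x (i - 1)))
    (hy1 : y 2 < y 1) (hy1neg : y 1 < 0) :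
    ∀ i : ℕ, 2 ≤ i → i ≤ m - 2 →
      ((x₀ / 4, y₀ / 2) ∉ Set.Ioo (x (i - 1)) (x₀ / 2) ×ˢ Set.Ioo (y i) (y₀ / 2)) ∧
      ((x₀ / 2, y₀ / 4) ∉ Set.Ioo (x (i - 1)) (x₀ / 2) ×ˢ Set.Ioo (y i) (y₀ / 2)) ∧
      (∀ j : ℕ, 1 ≤ j → j ≤ m - 2 →
        (x j, y j) ∉ Set.Ioo (x (i - 1)) (x₀ / 2) ×ˢ Set.Ioo (y i) (y₀ / 2)) := by
  intro i hi him
  refine ⟨fun h => lt_irrefl _ h.2.2, fun h => lt_irrefl _ h.1.2, ?_⟩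
  rintro j hj hjm ⟨⟨hxj, -⟩, hyj, -⟩
  dsimp only at hxj hyj
  have x_mono : ∀ a b : ℕ, 1 ≤ a → a ≤ b → b ≤ m - 2 → x a ≤ x b := by
    intro a b ha hab hb
    rcases hab.eq_or_lt with rfl | hlt
    · exact le_rfl
    · exact (hmono a b ha hlt hb).le
  rcases le_or_gt i j with hij | hji
  · have hx_le : x (i - 1) ≤ x (j - 1) := x_mono _ _ (by omega) (by omega) (by omega)
    have hx_neg : x (j - 1) ≤ x (m - 2) := x_mono _ _ (by omega) (by omega) le_rfl
    have hpos : 0 < x₀ / 2 - x (j - 1) := by linarith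
    have hdiv : x₀ * y₀ / (x₀ / 2 - x (i - 1)) ≤ x₀ * y₀ / (x₀ / 2 - x (j - 1)) :=
      div_le_div_of_nonneg_left (by positivity) hpos (by linarith)
    rw [hy i hi him, hy j (hi.trans hij) hjm] at hyj
    linarith
  · exact hxj.not_ge (x_mono _ _ hj (by omega) (by omega))
end

section
/- Let r, c be positive integers, M a real matrix with rows indexed by {1,…,r} and columns by {1,…,c}, and j₁, j₂ : {1,…,r} → ℤ two functions with j₁(i) ≤ j₂(i) for all i, both nonincreasing (i ≤ k implies j₁(i) ≥ j₁(k) and j₂(i) ≥ j₂(k)). Suppose that: (a) M(i,j) > 0 whenever j₁(i) ≤ j ≤ j₂(i); (b) M(i,j) = 0 whenever j < j₁(i); (c) M(i,j) = j₂(i) − j whenever j > j₂(i); and (d) the defined (positive) portion of M is totally inversely monotone, i.e., for all i < k and j < l with M(i,j) > 0, M(i,l) > 0, M(k,j) > 0, M(k,l) > 0, if M(k,j) ≤ M(k,l) then M(i,j) ≤ M(i,l). Then M is totally inversely monotone: for all i < k and j < l, M(k,j) ≤ M(k,l) implies M(i,j) ≤ M(i,l). -/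
/-- **Lemma 2.3.**  Let `M` be an `r × c` real matrix that is staircase-defined by two
nonincreasing functions `j₁ ≤ j₂`: the entries in row `i` at columns `j` with `j₁(i) ≤ j ≤ j₂(i)`
are positive, the left undefined portion (`j < j₁(i)`) is padded with `0`'s, and the right
undefined portion (`j > j₂(i)`) is padded with the negative numbers `j₂(i) − j`, decreasing in
`j`.  If the defined (positive) portion of `M` is totally inversely monotone, then `M` is totally
inversely monotone: for all `i < k` and `j < l`, `M(k,j) ≤ M(k,l)` implies `M(i,j) ≤ M(i,l)`. -/
theorem padded_staircase_matrix_totally_inverse_monotone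
    (r c : ℕ) (hr : 0 < r) (hc : 0 < c)
    (M : ℕ → ℕ → ℝ) (j₁ j₂ : ℕ → ℤ)
    (hj : ∀ i : ℕ, 1 ≤ i → i ≤ r → j₁ i ≤ j₂ i)
    (hj₁mono : ∀ i k : ℕ, 1 ≤ i → i ≤ k → k ≤ r → j₁ k ≤ j₁ i)
    (hj₂mono : ∀ i k : ℕ, 1 ≤ i → i ≤ k → k ≤ r → j₂ k ≤ j₂ i)
    (hpos : ∀ i j : ℕ, 1 ≤ i → i ≤ r → 1 ≤ j → j ≤ c →
      j₁ i ≤ (j : ℤ) → (j : ℤ) ≤ j₂ i → 0 < M i j)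
    (hleft : ∀ i j : ℕ, 1 ≤ i → i ≤ r → 1 ≤ j → j ≤ c →
      (j : ℤ) < j₁ i → M i j = 0)
    (hright : ∀ i j : ℕ, 1 ≤ i → i ≤ r → 1 ≤ j → j ≤ c →
      j₂ i < (j : ℤ) → M i j = ((j₂ i - j : ℤ) : ℝ))
    (hdef : ∀ i k j l : ℕ, 1 ≤ i → i < k → k ≤ r → 1 ≤ j → j < l → l ≤ c →
      0 < M i j → 0 < M i l → 0 < M k j → 0 < M k l →
      M k j ≤ M k l → M i j ≤ M i l) :
    ∀ i k j l : ℕ, 1 ≤ i → i < k → k ≤ r → 1 ≤ j → j < l → l ≤ c →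
      M k j ≤ M k l → M i j ≤ M i l := by
  intro i k j l hi hik hkr hj1 hjl hlc hkjl
  have hirange : i ≤ r := by omega
  have hk : 1 ≤ k := by omega
  have hl : 1 ≤ l := by omega
  have hjc : j ≤ c := by omega
  have h₁ := hj₁mono i k hi hik.le hkr
  have h₂ := hj₂mono i k hi hik.le hkr
  have hlk : (l : ℤ) ≤ j₂ k := by
    by_contra! hlt
    rw [hright k l hk hkr hl hlc hlt] at hkjl
    rcases lt_or_ge (j₂ k) (j : ℤ) with hjk | hjk
    · rw [hright k j hk hkr hj1 hjc hjk] at hkjl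
      have := Int.cast_le.mp hkjl
      omega
    · have hneg : ((j₂ k - l : ℤ) : ℝ) < 0 := Int.cast_lt_zero.mpr (by omega)
      have hnonneg : 0 ≤ M k j := by
        rcases lt_or_ge (j : ℤ) (j₁ k) with hjk' | hjk'
        · exact (hleft k j hk hkr hj1 hjc hjk').ge
        · exact (hpos k j hk hkr hj1 hjc hjk' hjk).le
      linarith
  rcases lt_or_ge (j : ℤ) (j₁ i) with hji | hji
  · rw [hleft i j hi hirange hj1 hjc hji]
    rcases lt_or_ge (l : ℤ) (j₁ i) with hli | hli
    · exact (hleft i l hi hirange hl hlc hli).ge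
    · exact (hpos i l hi hirange hl hlc hli (by omega)).le
  · exact hdef i k j l hi hik hkr hj1 hjl hlc
      (hpos i j hi hirange hj1 hjc hji (by omega))
      (hpos i l hi hirange hl hlc (by omega) (by omega))
      (hpos k j hk hkr hj1 hjc (by omega) (by omega))
      (hpos k l hk hkr hl hlc (by omega) hlk) hkjl
end

section
/- Let r, c be positive integers, M a real matrix with rows indexed by {1,…,r} and columns by {1,…,c}, and j₁, j₂ : {1,…,r} → ℤ two functions with j₁(i) ≤ j₂(i) for all i, both nondecreasing (i ≤ k implies j₁(i) ≤ j₁(k) and j₂(i) ≤ j₂(k)). Suppose that: (a) M(i,j) > 0 whenever j₁(i) ≤ j ≤ j₂(i); (b) M(i,j) = j − j₁(i) whenever j < j₁(i); (c) M(i,j) = 0 whenever j > j₂(i); and (d) the defined (positive) portion of M is totally monotone, i.e., for all i < k and j < l with M(i,j) > 0, M(i,l) > 0, M(k,j) > 0, M(k,l) > 0, if M(i,j) < M(i,l) then M(k,j) < M(k,l). Then M is totally monotone: for all i < k and j < l, M(i,j) < M(i,l) implies M(k,j) < M(k,l). -/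
/-- The variant of Lemma 2.3 for nondecreasing staircase functions.  Let `M` be an `r × c` real
matrix that is staircase-defined by two nondecreasing functions `j₁ ≤ j₂`: the entries in row `i`
at columns `j` with `j₁(i) ≤ j ≤ j₂(i)` are positive, the left undefined portion (`j < j₁(i)`) is
padded with the negative numbers `j − j₁(i)`, increasing in `j`, and the right undefined portion
(`j > j₂(i)`) is padded with `0`'s.  If the defined (positive) portion of `M` is totally
monotone, then `M` is totally monotone: for all `i < k` and `j < l`, `M(i,j) < M(i,l)` implies
`M(k,j) < M(k,l)`. -/
theorem padded_staircase_matrix_totally_monotone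
    (r c : ℕ) (hr : 0 < r) (hc : 0 < c)
    (M : ℕ → ℕ → ℝ) (j₁ j₂ : ℕ → ℤ)
    (hj : ∀ i : ℕ, 1 ≤ i → i ≤ r → j₁ i ≤ j₂ i)
    (hj₁mono : ∀ i k : ℕ, 1 ≤ i → i ≤ k → k ≤ r → j₁ i ≤ j₁ k)
    (hj₂mono : ∀ i k : ℕ, 1 ≤ i → i ≤ k → k ≤ r → j₂ i ≤ j₂ k)
    (hpos : ∀ i j : ℕ, 1 ≤ i → i ≤ r → 1 ≤ j → j ≤ c →
      j₁ i ≤ (j : ℤ) → (j : ℤ) ≤ j₂ i → 0 < M i j)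
    (hleft : ∀ i j : ℕ, 1 ≤ i → i ≤ r → 1 ≤ j → j ≤ c →
      (j : ℤ) < j₁ i → M i j = ((j - j₁ i : ℤ) : ℝ))
    (hright : ∀ i j : ℕ, 1 ≤ i → i ≤ r → 1 ≤ j → j ≤ c →
      j₂ i < (j : ℤ) → M i j = 0)
    (hdef : ∀ i k j l : ℕ, 1 ≤ i → i < k → k ≤ r → 1 ≤ j → j < l → l ≤ c →
      0 < M i j → 0 < M i l → 0 < M k j → 0 < M k l →
      M i j < M i l → M k j < M k l) :
    ∀ i k j l : ℕ, 1 ≤ i → i < k → k ≤ r → 1 ≤ j → j < l → l ≤ c →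
      M i j < M i l → M k j < M k l := by
  intro i k j l hi hik hkr hj1 hjl hlc h
  have hk : 1 ≤ k := by omega
  have hir : i ≤ r := by omega
  have hl1 : 1 ≤ l := by omega
  have hjc : j ≤ c := by omega
  have m₁ := hj₁mono i k hi hik.le hkr
  have m₂ := hj₂mono i k hi hik.le hkr
  rcases lt_or_ge (j : ℤ) (j₁ k) with hjk | hjk
  · -- The entry at `(k, j)` is negative padding, smaller than everything to its right.
    rw [hleft k j hk hkr hj1 hjc hjk]
    rcases lt_or_ge (l : ℤ) (j₁ k) with hlk | hlk
    · rw [hleft k l hk hkr hl1 hlc hlk]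
      exact_mod_cast (by omega : (j : ℤ) - j₁ k < l - j₁ k)
    · have hneg : (((j : ℤ) - j₁ k : ℤ) : ℝ) < 0 := by
        exact_mod_cast (by omega : (j : ℤ) - j₁ k < 0)
      rcases le_or_gt (l : ℤ) (j₂ k) with hlk' | hlk'
      · exact hneg.trans (hpos k l hk hkr hl1 hlc hlk hlk')
      · rwa [hright k l hk hkr hl1 hlc hlk']
  · -- Otherwise all four entries lie in the defined portion.
    have hji : (j : ℤ) ≤ j₂ i := by
      by_contra! hlt
      rw [hright i j hi hir hj1 hjc hlt, hright i l hi hir hl1 hlc (by omega)] at h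
      exact lt_irrefl _ h
    have hij := hpos i j hi hir hj1 hjc (by omega) hji
    have hli : (l : ℤ) ≤ j₂ i := by
      by_contra! hlt
      rw [hright i l hi hir hl1 hlc hlt] at h
      exact lt_asymm h hij
    exact hdef i k j l hi hik hkr hj1 hjl hlc hij (hij.trans h)
      (hpos k j hk hkr hj1 hjc hjk (by omega)) (hpos k l hk hkr hl1 hlc (by omega) (by omega)) h
end

section
/- Let m ≥ 3 be an integer and let 0 ≤ a₁ < a₂ < ⋯ < a_m ≤ 1 be real numbers. Define the blue points p_k = (a_k, 1/(1+a_k)) and q_k = (−a_k, −1/(1+a_k)) for 1 ≤ k ≤ m. Then for all indices 1 ≤ i < j ≤ m, the open rectangle (−a_j, a_j) × (−1/(1+a_i), 1/(1+a_i)) contains none of the 2m blue points p₁, …, p_m, q₁, …, q_m if and only if j = i + 1 (i.e., if and only if a_i and a_j are adjacent in the sorted order of the numbers). -/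
/-- The point `(x, 1/(1+x))` lies in the open rectangle `(-b, b) × (-1/(1+c), 1/(1+c))` exactly
when `c < x < b`. -/
theorem mem_reduction_rectangle_iff {x b c : ℝ} (hx : 0 ≤ x) (hc : 0 ≤ c) :
    (x, 1 / (1 + x)) ∈ Set.Ioo (-b) b ×ˢ Set.Ioo (-(1 / (1 + c))) (1 / (1 + c)) ↔
      c < x ∧ x < b := by
  have hx' : 0 < 1 / (1 + x) := by positivity
  have hc' : 0 < 1 / (1 + c) := by positivity
  have key : 1 / (1 + x) < 1 / (1 + c) ↔ c < x := by
    rw [one_div_lt_one_div (by positivity) (by positivity), add_lt_add_iff_left]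
  simp only [Set.mem_prod, Set.mem_Ioo, key]
  constructor
  · rintro ⟨⟨-, hxb⟩, -, hcx⟩
    exact ⟨hcx, hxb⟩
  · rintro ⟨hcx, hxb⟩
    exact ⟨⟨by linarith, hxb⟩, by linarith, hcx⟩

/-- An open rectangle centred at the origin is symmetric under negation of both coordinates. -/
theorem neg_mem_centred_rectangle_iff {x y b h : ℝ} :
    (-x, -y) ∈ Set.Ioo (-b) b ×ˢ Set.Ioo (-h) h ↔
      (x, y) ∈ Set.Ioo (-b) b ×ˢ Set.Ioo (-h) h := by
  simp only [Set.mem_prod, Set.mem_Ioo, neg_lt_neg_iff, neg_lt (a := x), neg_lt (a := y)]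
  tauto

/-- The key property of the reduction from the 1D-Furthest-Adjacent-Pair problem: with `m ≥ 3`,
`0 ≤ a₁ < a₂ < ⋯ < a_m ≤ 1`, and blue points `p_k = (a_k, 1/(1+a_k))`,
`q_k = (−a_k, −1/(1+a_k))` for `1 ≤ k ≤ m`, the interior
`(−a_j, a_j) × (−1/(1+a_i), 1/(1+a_i))` of the candidate rectangle `S_{ij}` (for `1 ≤ i < j ≤ m`)
contains none of the `2m` blue points if and only if `j = i + 1`, i.e. if and only if `a_i` and
`a_j` are adjacent in the sorted order. -/
theorem reduction_rectangle_blue_empty_iff_adjacent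
    (m : ℕ) (hm : 3 ≤ m) (a : ℕ → ℝ)
    (ha0 : 0 ≤ a 1) (ha1 : a m ≤ 1)
    (hmono : ∀ i j : ℕ, 1 ≤ i → i < j → j ≤ m → a i < a j) :
    ∀ i j : ℕ, 1 ≤ i → i < j → j ≤ m →
      ((∀ k : ℕ, 1 ≤ k → k ≤ m →
          (a k, 1 / (1 + a k)) ∉
            Set.Ioo (-(a j)) (a j) ×ˢ Set.Ioo (-(1 / (1 + a i))) (1 / (1 + a i)) ∧
          (-(a k), -(1 / (1 + a k))) ∉
            Set.Ioo (-(a j)) (a j) ×ˢ Set.Ioo (-(1 / (1 + a i))) (1 / (1 + a i))) ↔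
        j = i + 1) := by
  intro i j hi hij hj
  have nonneg : ∀ k, 1 ≤ k → k ≤ m → 0 ≤ a k := by
    intro k hk hkm
    rcases hk.eq_or_lt with rfl | hk
    · exact ha0
    · exact ha0.trans (hmono 1 k le_rfl hk hkm).le
  have hai := nonneg i hi (by omega)
  constructor
  · intro h
    by_contra hne
    refine (h (i + 1) (by omega) (by omega)).1 ?_
    rw [mem_reduction_rectangle_iff (nonneg _ (by omega) (by omega)) hai]
    exact ⟨hmono _ _ hi (by omega) (by omega), hmono _ _ (by omega) (by omega) hj⟩
  · rintro rfl k hk hkm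
    rw [neg_mem_centred_rectangle_iff, and_self, mem_reduction_rectangle_iff (nonneg k hk hkm) hai]
    rintro ⟨hik, hkj⟩
    rcases Nat.lt_trichotomy k i with hlt | rfl | hlt
    · exact hik.not_gt (hmono k i hk hlt (by omega))
    · exact hik.false
    · rcases (Nat.succ_le_of_lt hlt).eq_or_lt with rfl | hlt
      · exact hkj.false
      · exact hkj.not_gt (hmono _ k (by omega) hlt hkm)
end
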